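/- Rational solutions of Painlevé IV from Okamoto polynomials: let α₁, α₂ ≥ 1 be integers, let Ω_{α₁,α₂} = {1 + 3i : 0 ≤ i < α₁} ∪ {2 + 3i : 0 ≤ i < α₂}, and let H^{Ω}(z) denote the Wronskian of the Hermite polynomials H_n with n ∈ Ω taken in increasing order (H^∅ = 1). Define y(t) = −2t/3 + (d/dt)[log(H^{Ω_{α₁,α₂}}(t/√3) / H^{Ω_{α₁−1,α₂−1}}(t/√3))]. Then at every t ∈ ℝ where H^{Ω_{α₁,α₂}}(t/√3) ≠ 0, H^{Ω_{α₁−1,α₂−1}}(t/√3) ≠ 0 and y(t) ≠ 0, y satisfies the Painlevé IV equation y″ = (y′)²/(2y) + (3/2)y³ + 4t·y² + 2(t² − a)·y + b/y with parameters a = α₁ + α₂ and b = −(2/9)·(3(α₁ − α₂) − 1)². -/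

import Mathlib

/-- The physicists' Hermite polynomials:
`H₀ = 1`, `H₁ = 2x`, `H_{n+1} = 2x·H_n − 2n·H_{n-1}`. -/
noncomputable def hermiteH : ℕ → Polynomial ℝ
  | 0 => 1
  | 1 => Polynomial.C 2 * Polynomial.X
  | n + 2 => Polynomial.C 2 * Polynomial.X * hermiteH (n + 1)
      - Polynomial.C (2 * ((n : ℝ) + 1)) * hermiteH n

/-- The Wronskian of a list of functions: the determinant of the matrix whose
`(i, j)` entry is the `i`-th derivative of the `j`-th function (0-indexed);
the empty Wronskian is `1`. -/
noncomputable def wronskian (fs : List (ℝ → ℝ)) (z : ℝ) : ℝ :=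
  Matrix.det (Matrix.of fun i j : Fin fs.length => iteratedDeriv i.val (fs.get j) z)

/-- The Wronskian of the Hermite polynomials indexed by a finite set `S ⊆ ℕ`,
taken in increasing order. -/
noncomputable def hermiteWronskian (S : Finset ℕ) (z : ℝ) : ℝ :=
  wronskian ((S.sort (· ≤ ·)).map fun n => fun x => (hermiteH n).eval x) z

/-- The 3-Okamoto Maya diagram `Ω_{α₁,α₂} = {1+3i : i < α₁} ∪ {2+3i : i < α₂}`. -/
def OmegaMaya (a1 a2 : ℕ) : Finset ℕ :=
  ((Finset.range a1).image fun i => 1 + 3 * i) ∪ ((Finset.range a2).image fun i => 2 + 3 * i)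

/-- A derivation of a domain extends to its field of fractions. -/
theorem exists_derivation_extending {A K : Type*} [CommRing A] [Field K] [Algebra A K]
    [IsFractionRing A K] (d : Derivation ℤ A A) :
    ∃ D : Derivation ℤ K K, ∀ a, D (algebraMap A K a) = algebraMap A K (d a) := by
  have hA : IsDomain A := (IsFractionRing.injective A K).isDomain
  let ι := algebraMap A K
  let f : A →+* TrivSqZeroExt K K :=
    { toFun := fun a => .inl (ι a) + .inr (ι (d a))
      map_one' := by ext <;> simp
      map_zero' := by ext <;> simp
      map_add' := fun a b => by ext <;> simp only [map_add, TrivSqZeroExt.fst_add,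
        TrivSqZeroExt.snd_add, TrivSqZeroExt.fst_inl, TrivSqZeroExt.fst_inr,
        TrivSqZeroExt.snd_inl, TrivSqZeroExt.snd_inr] <;> ring
      map_mul' := fun a b => by
        ext <;> simp only [map_mul, map_add, Derivation.leibniz, smul_eq_mul,
          TrivSqZeroExt.fst_add, TrivSqZeroExt.snd_add, TrivSqZeroExt.fst_inl,
          TrivSqZeroExt.fst_inr, TrivSqZeroExt.snd_inl, TrivSqZeroExt.snd_inr,
          TrivSqZeroExt.fst_mul, TrivSqZeroExt.snd_mul, MulOpposite.smul_eq_mul_unop,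
          MulOpposite.unop_op] <;> ring }
  have hf1 : ∀ a, (f a).fst = ι a := fun a => by
    change (TrivSqZeroExt.inl (ι a) + TrivSqZeroExt.inr (ι (d a))).fst = _
    simp only [TrivSqZeroExt.fst_add, TrivSqZeroExt.fst_inl, TrivSqZeroExt.fst_inr, add_zero]
  have hf2 : ∀ a, (f a).snd = ι (d a) := fun a => by
    change (TrivSqZeroExt.inl (ι a) + TrivSqZeroExt.inr (ι (d a))).snd = _
    simp only [TrivSqZeroExt.snd_add, TrivSqZeroExt.snd_inl, TrivSqZeroExt.snd_inr, zero_add]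
  have hf : ∀ s : nonZeroDivisors A, IsUnit (f s) := fun s => by
    rw [TrivSqZeroExt.isUnit_iff_isUnit_fst, hf1]
    exact IsLocalization.map_units K s
  let g : K →+* TrivSqZeroExt K K := IsLocalization.lift hf
  have hg : ∀ a, g (algebraMap A K a) = f a := IsLocalization.lift_eq hf
  have hfst : ∀ x, (g x).fst = x := fun x =>
    RingHom.congr_fun (f := (TrivSqZeroExt.fstHom ℤ K K).toRingHom.comp g) (g := RingHom.id K)
      (IsLocalization.ringHom_ext (nonZeroDivisors A) (by
        ext a
        change (g (algebraMap A K a)).fst = _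
        rw [hg, hf1]; rfl)) x
  refine ⟨Derivation.mk' (AddMonoidHom.toIntLinearMap
    { toFun := fun x => (g x).snd
      map_zero' := by rw [map_zero, TrivSqZeroExt.snd_zero]
      map_add' := fun x y => by rw [map_add, TrivSqZeroExt.snd_add] }) ?_, ?_⟩
  · intro a b
    change (g (a * b)).snd = a • (g b).snd + b • (g a).snd
    rw [map_mul, TrivSqZeroExt.snd_mul, hfst, hfst, op_smul_eq_smul]
  · intro a
    change (g (algebraMap A K a)).snd = _
    rw [hg, hf2]

section Wronskian

variable {K : Type*} [Field K] (D : Derivation ℤ K K)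

/-- The Wronskian of a list of elements of a differential field. -/
def fieldWronskian (fs : List K) : K :=
  Matrix.det (Matrix.of fun i j : Fin fs.length => D^[i] (fs.get j))

/-- The coefficients of the Leibniz expansion of `D^[i] (c * g)`. -/
def leibnizCoeff (c : K) : ℕ → ℕ → K
  | 0, 0 => c
  | 0, _ + 1 => 0
  | i + 1, 0 => D (leibnizCoeff c i 0)
  | i + 1, l + 1 => D (leibnizCoeff c i (l + 1)) + leibnizCoeff c i l

theorem leibnizCoeff_of_lt (c : K) : ∀ {i l : ℕ}, i < l → leibnizCoeff D c i l = 0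
  | 0, _ + 1, _ => rfl
  | i + 1, l + 1, h => by
    simp [leibnizCoeff, leibnizCoeff_of_lt c (show i < l + 1 by omega),
      leibnizCoeff_of_lt c (show i < l by omega)]

theorem leibnizCoeff_self (c : K) : ∀ i : ℕ, leibnizCoeff D c i i = c
  | 0 => rfl
  | i + 1 => by
    simp [leibnizCoeff, leibnizCoeff_of_lt D c (Nat.lt_succ_self i), leibnizCoeff_self c i]

theorem iterate_derivation_mul (c g : K) (i n : ℕ) (h : i < n) :
    D^[i] (c * g) = ∑ l ∈ Finset.range n, leibnizCoeff D c i l * D^[l] g := by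
  induction i generalizing n with
  | zero =>
    obtain ⟨m, rfl⟩ : ∃ m, n = m + 1 := ⟨n - 1, by omega⟩
    rw [Finset.sum_range_succ']
    simp [leibnizCoeff]
  | succ i ih =>
    obtain ⟨m, rfl⟩ : ∃ m, n = m + 1 := ⟨n - 1, by omega⟩
    rw [Function.iterate_succ_apply', ih m (by omega), Finset.sum_range_succ', map_sum]
    have h2 : ∑ l ∈ Finset.range m, D (leibnizCoeff D c i l) * D^[l] g =
        ∑ l ∈ Finset.range m, D (leibnizCoeff D c i (l + 1)) * D^[l + 1] g
          + D (leibnizCoeff D c i 0) * g := by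
      have := Finset.sum_range_succ' (fun l => D (leibnizCoeff D c i l) * D^[l] g) m
      rw [Finset.sum_range_succ, leibnizCoeff_of_lt D c (show i < m by omega)] at this
      simpa using this
    simp only [Derivation.leibniz, smul_eq_mul, Finset.sum_add_distrib, leibnizCoeff, add_mul,
      Function.iterate_succ_apply', Function.iterate_zero, id] at h2 ⊢
    rw [Finset.sum_congr rfl fun l _ => mul_comm (D^[l] g) _, h2]
    ring

theorem det_iterate_derivation_mul (c : K) {n : ℕ} (g : Fin n → K) :
    Matrix.det (Matrix.of fun i j : Fin n => D^[i] (c * g j)) =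
      c ^ n * Matrix.det (Matrix.of fun i j : Fin n => D^[i] (g j)) := by
  have h : (Matrix.of fun i j : Fin n => D^[i] (c * g j)) =
      (Matrix.of fun i l : Fin n => leibnizCoeff D c i l) *
        Matrix.of fun i j : Fin n => D^[i] (g j) := by
    ext i j
    rw [Matrix.mul_apply, Matrix.of_apply, iterate_derivation_mul D c (g j) i n i.2,
      Finset.sum_range]
    rfl
  rw [h, Matrix.det_mul, Matrix.det_of_isLowerTriangular]
  · simp [leibnizCoeff_self]
  · intro i j hij
    exact leibnizCoeff_of_lt D c (by simpa using hij)

theorem fieldWronskian_map {ι : Type*} (φ : ι → K) (l : List ι) :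
    fieldWronskian D (l.map φ) =
      Matrix.det (Matrix.of fun i j : Fin l.length => D^[i] (φ (l.get j))) := by
  rw [fieldWronskian,
    ← Matrix.det_submatrix_equiv_self (finCongr (List.length_map (as := l) φ).symm)]
  congr 1
  ext i j
  simp

/-- The Darboux transformation `g ↦ f (g / f)'` with seed `f`. -/
def darboux (f g : K) : K := D g - D f / f * g

@[simp]
theorem fieldWronskian_nil : fieldWronskian D [] = 1 := Matrix.det_fin_zero

theorem fieldWronskian_cons (f : K) (fs : List K) :
    fieldWronskian D (f :: fs) = f * fieldWronskian D (fs.map (darboux D f)) := by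
  by_cases hf : f = 0
  · subst hf
    rw [zero_mul]
    refine Matrix.det_eq_zero_of_column_eq_zero (0 : Fin (fs.length + 1)) fun i => ?_
    change D^[i] 0 = 0
    exact Function.iterate_fixed (map_zero D) _
  have h1 : fieldWronskian D (f :: fs) = f ^ (fs.length + 1) *
      Matrix.det (Matrix.of fun i j : Fin (fs.length + 1) =>
        D^[i] (f⁻¹ * (f :: fs).get j)) := by
    rw [← det_iterate_derivation_mul]
    simp only [mul_inv_cancel_left₀ hf]
    rfl
  have hD : ∀ g : K, f * D (f⁻¹ * g) = darboux D f g := fun g => by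
    rw [Derivation.leibniz, Derivation.leibniz_inv, darboux]
    simp only [smul_eq_mul]
    field_simp
    ring
  have hz : ∀ i : ℕ, D^[i + 1] (1 : K) = 0 := fun i => by
    rw [Function.iterate_succ_apply, Derivation.map_one_eq_zero]
    exact Function.iterate_fixed (map_zero D) _
  rw [h1, fieldWronskian_map, Matrix.det_succ_column_zero, Fin.sum_univ_succ,
    Finset.sum_eq_zero]
  · simp only [← hD]
    rw [det_iterate_derivation_mul]
    have hg : (Matrix.of fun i j : Fin (fs.length + 1) =>
        D^[i] (f⁻¹ * (f :: fs).get j)).submatrix (Fin.succAbove 0) Fin.succ =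
        Matrix.of fun i j : Fin fs.length => D^[i] (D (f⁻¹ * fs.get j)) := rfl
    rw [hg]
    simp [hf]
    ring
  · intro i _
    simp [hf, hz]

theorem fieldWronskian_swap (x y : K) (l : List K) :
    fieldWronskian D (y :: x :: l) = -fieldWronskian D (x :: y :: l) := by
  rw [fieldWronskian, fieldWronskian]
  have := Matrix.det_permute' (Equiv.swap (0 : Fin (l.length + 2)) 1)
    (Matrix.of fun i j : Fin (l.length + 2) => D^[i] ((x :: y :: l).get j))
  rw [Equiv.Perm.sign_swap (by simp)] at this
  simp only [Units.val_neg, Units.val_one, Int.cast_neg, Int.cast_one, neg_mul, one_mul] at this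
  refine Eq.trans ?_ this
  congr 1
  ext i j
  refine Fin.cases ?_ (fun j => ?_) j
  · simp
  refine Fin.cases ?_ (fun j => ?_) j
  · simp
  · rw [Matrix.submatrix_apply, id, Equiv.swap_apply_of_ne_of_ne]
    · rfl
    · exact Fin.succ_ne_zero _
    · simp [Fin.ext_iff]

theorem fieldWronskian_map_perm {ι : Type*} {l₁ l₂ : List ι} (h : l₁.Perm l₂) (φ : ι → K) :
    fieldWronskian D (l₁.map φ) = fieldWronskian D (l₂.map φ) ∨
      fieldWronskian D (l₁.map φ) = -fieldWronskian D (l₂.map φ) := by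
  induction h generalizing φ with
  | nil => exact .inl rfl
  | swap x y l => exact .inr (fieldWronskian_swap D _ _ _)
  | cons x h ih =>
    simp only [List.map_cons, fieldWronskian_cons, List.map_map]
    rcases ih (darboux D (φ x) ∘ φ) with h | h <;> simp [h]
  | trans _ _ ih₁ ih₂ =>
    rcases ih₁ φ with h₁ | h₁ <;> rcases ih₂ φ with h₂ | h₂ <;> simp [h₁, h₂]

/-- Eigenfunctions of `g ↦ g'' - 2 z g' + U g`, with eigenvalue `μ`. -/
def IsEigen (z U μ g : K) : Prop := D (D g) - 2 * z * D g + U * g = μ * g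

variable {D}

theorem IsEigen.darboux {z U μ ν f g : K} (hz : D z = 1) (hμ : D μ = 0) (hν : D ν = 0)
    (hf0 : f ≠ 0) (hf : IsEigen D z U μ f) (hg : IsEigen D z U ν g) :
    IsEigen D z (U + 2 * D (D f / f) - 2) ν (darboux D f g) := by
  have h2 : D (2 : K) = 0 := by exact_mod_cast D.map_natCast 2
  have hU : U = μ + 2 * z * (D f / f) - D (D f / f) - (D f / f) ^ 2 := by
    have hv : D (D f) = (D (D f / f) + (D f / f) ^ 2) * f := by
      rw [Derivation.leibniz_div]; simp only [smul_eq_mul]; field_simp; ring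
    unfold IsEigen at hf
    rw [hv] at hf
    have : D f = D f / f * f := by field_simp
    generalize D f / f = v at *
    rw [this] at hf
    apply mul_right_cancel₀ hf0
    linear_combination hf
  unfold IsEigen _root_.darboux at *
  generalize D f / f = v at *
  have hg2 : D (D g) = ν * g + 2 * z * D g - U * g := by linear_combination hg
  subst hU
  simp only [map_add, map_sub, Derivation.leibniz, smul_eq_mul, hg2, hz, h2, hμ, hν, pow_two]
  ring

theorem darboux_ne_zero {z U μ ν f g : K} (hf0 : f ≠ 0) (hg0 : g ≠ 0) (hμν : μ ≠ ν)
    (hf : IsEigen D z U μ f) (hg : IsEigen D z U ν g) : darboux D f g ≠ 0 := by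
  intro h
  have h1 : D g = D f / f * g := sub_eq_zero.mp h
  have h2 : D (D g) = D (D f) / f * g := by
    rw [h1, Derivation.leibniz, Derivation.leibniz_div, h1]
    simp only [smul_eq_mul]; field_simp; ring
  unfold IsEigen at hf hg
  rw [h2, h1] at hg
  apply hμν
  apply mul_right_cancel₀ (mul_ne_zero hf0 hg0)
  field_simp at hg
  linear_combination g * (hg - hf)

theorem fieldWronskian_ne_zero {ι : Type*} {z U : K} (hz : D z = 1) (e : ι → K)
    (hc : ∀ n, D (e n) = 0) (l : List ι)
    (φ : ι → K) (h0 : ∀ n ∈ l, φ n ≠ 0) (he : ∀ n ∈ l, IsEigen D z U (e n) (φ n))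
    (hl : l.Pairwise fun m n => e m ≠ e n) : fieldWronskian D (l.map φ) ≠ 0 := by
  induction l generalizing U φ with
  | nil => simp
  | cons a l ih =>
    rw [List.pairwise_cons] at hl
    rw [List.forall_mem_cons] at h0 he
    rw [List.map_cons, fieldWronskian_cons, List.map_map]
    refine mul_ne_zero h0.1 (ih (U := U + 2 * D (D (φ a) / φ a) - 2) _
      (fun n hn => ?_) (fun n hn => ?_) hl.2)
    · exact darboux_ne_zero h0.1 (h0.2 n hn) (hl.1 n hn) he.1 (he.2 n hn)
    · exact he.1.darboux hz (hc _) (hc _) h0.1 (he.2 n hn)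

variable (D) in
/-- Half of the Hirota bilinear derivative `D² τ·σ` with a drift term. -/
def hirota (z τ σ : K) : K :=
  τ * D (D σ) - 2 * (D τ * D σ) + D (D τ) * σ - 2 * z * (τ * D σ - D τ * σ)

/-- Consecutive Wronskians of eigenfunctions satisfy a Hirota bilinear equation. -/
theorem hirota_fieldWronskian {ι : Type*} {z U : K} (hz : D z = 1) (e : ι → K)
    (hc : ∀ n, D (e n) = 0) (l : List ι)
    (a : ι) (φ : ι → K) (he : ∀ n ∈ l, IsEigen D z U (e n) (φ n))
    (ha : IsEigen D z U (e a) (φ a)) :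
    hirota D z (fieldWronskian D (l.map φ)) (fieldWronskian D ((l ++ [a]).map φ)) =
      (e a - U + 2 * l.length) * (fieldWronskian D (l.map φ) *
        fieldWronskian D ((l ++ [a]).map φ)) := by
  induction l generalizing U φ with
  | nil =>
    unfold IsEigen at ha
    simp [fieldWronskian_cons, hirota]
    linear_combination ha
  | cons b l ih =>
    rw [List.forall_mem_cons] at he
    simp only [List.cons_append, List.map_cons, fieldWronskian_cons, List.map_map]
    by_cases hb : φ b = 0
    · simp [hb, hirota]
    have := ih (darboux D (φ b) ∘ φ) (fun n hn => he.1.darboux hz (hc _) (hc _) hb (he.2 n hn))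
      (he.1.darboux hz (hc _) (hc _) hb ha)
    generalize fieldWronskian D (l.map (darboux D (φ b) ∘ φ)) = τ at *
    generalize fieldWronskian D ((l ++ [a]).map (darboux D (φ b) ∘ φ)) = σ at *
    have hv : D (D (φ b) / φ b) * φ b ^ 2 = φ b * D (D (φ b)) - D (φ b) ^ 2 := by
      rw [Derivation.leibniz_div]; simp only [smul_eq_mul]; field_simp
    simp only [hirota, map_add, Derivation.leibniz, smul_eq_mul, List.length_cons] at *
    push_cast
    linear_combination φ b ^ 2 * this - 2 * τ * σ * hv

theorem hirota_mul_const {z c τ σ : K} (hc : D c = 0) :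
    hirota D z τ (c * σ) = c * hirota D z τ σ := by
  simp only [hirota, Derivation.leibniz, smul_eq_mul, hc, mul_zero, add_zero]
  ring

/-- A cycle of three bilinear equations yields a Painlevé IV equation for
`Y = (log τ₀ / τ₁)' - 2 z`. -/
theorem painleve_of_hirota_cycle {z τ₀ τ₁ τ₂ c₀ c₁ c₂ Y : K} (hz : D z = 1) (h₀ : τ₀ ≠ 0)
    (h₁ : τ₁ ≠ 0) (h₂ : τ₂ ≠ 0) (hc₁ : D c₁ = 0) (hc₂ : D c₂ = 0)
    (e₀ : hirota D z τ₀ τ₁ = c₀ * (τ₀ * τ₁)) (e₁ : hirota D z τ₁ τ₂ = c₁ * (τ₁ * τ₂))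
    (e₂ : hirota D z τ₂ τ₀ = c₂ * (τ₂ * τ₀)) (hY : Y = D τ₀ / τ₀ - D τ₁ / τ₁ - 2 * z) :
    2 * Y * D (D Y) - D Y ^ 2 + (2 + c₁ - c₂) ^ 2 +
      Y ^ 2 * (-3 * Y ^ 2 - 24 * z * Y - 36 * z ^ 2 + 2 * (2 * c₀ - c₁ - c₂)) = 0 := by
  have hD2 : D (2 : K) = 0 := by exact_mod_cast D.map_natCast 2
  have key : ∀ {τ σ c : K}, τ ≠ 0 → σ ≠ 0 → hirota D z τ σ = c * (τ * σ) →
      D (D τ / τ) + D (D σ / σ) + (D σ / σ - D τ / τ) ^ 2 -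
        2 * z * (D σ / σ - D τ / τ) = c := by
    intro τ σ c hτ hσ h
    apply mul_right_cancel₀ (mul_ne_zero hτ hσ)
    rw [← h, hirota, Derivation.leibniz_div, Derivation.leibniz_div]
    simp only [smul_eq_mul]
    field_simp
    ring
  have k₀ := key h₀ h₁ e₀
  have k₁ := key h₁ h₂ e₁
  have k₂ := key h₂ h₀ e₂
  generalize D τ₀ / τ₀ = u₀ at *
  generalize D τ₁ / τ₁ = u₁ at *
  generalize D τ₂ / τ₂ = u₂ at *
  have hDY : D Y = D u₀ - D u₁ - 2 := by
    rw [hY]; simp [hD2, hz]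
  obtain ⟨v, hv⟩ : ∃ v, v = 2 * u₂ - u₀ - u₁ := ⟨_, rfl⟩
  have hDv : D v = 2 * D u₂ - D u₀ - D u₁ := by rw [hv]; simp [hD2]
  have hvY : v * Y = D Y + 2 - c₂ + c₁ := by
    rw [hDY, hv, hY]
    linear_combination k₁ - k₂
  have hDvY := congrArg D hvY
  simp only [map_add, map_sub, Derivation.leibniz, smul_eq_mul, hD2, hc₁, hc₂] at hDvY
  have hv2 : 2 * D v + v ^ 2 - 3 * (u₁ - u₀) ^ 2 + 12 * z * (u₁ - u₀) =
      2 * (c₁ + c₂ - 2 * c₀) := by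
    rw [hDv, hv]
    linear_combination 2 * k₁ + 2 * k₂ - 4 * k₀
  have hw : u₁ - u₀ = -(Y + 2 * z) := by rw [hY]; ring
  rw [hw] at hv2
  have hDD : D (D Y) = v * D Y + Y * D v := by linear_combination -hDvY
  have hDY2 : D Y = v * Y - 2 + c₂ - c₁ := by linear_combination -hvY
  rw [hDD, hDY2]
  linear_combination Y ^ 2 * hv2

end Wronskian

section Hermite

open Polynomial

theorem hermiteH_succ_and_derivative (n : ℕ) :
    hermiteH (n + 1) = 2 * X * hermiteH n - derivative (hermiteH n) ∧
      derivative (hermiteH (n + 1)) = 2 * ((n : ℝ[X]) + 1) * hermiteH n := by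
  have hC : (C 2 : ℝ[X]) = 2 := rfl
  induction n with
  | zero => simp [hermiteH, hC]
  | succ n ih =>
    have h1 : hermiteH (n + 1 + 1) =
        2 * X * hermiteH (n + 1) - derivative (hermiteH (n + 1)) := by
      rw [ih.2, hermiteH]
      simp [hC]
    refine ⟨h1, ?_⟩
    have h2 : hermiteH (n + 2) = 2 * X * hermiteH (n + 1) - 2 * ((n : ℝ[X]) + 1) * hermiteH n := by
      rw [h1, ih.2]
    have h3 : derivative (hermiteH n) = 2 * X * hermiteH n - hermiteH (n + 1) := by
      rw [ih.1]; ring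
    rw [h2]
    simp only [derivative_sub, derivative_mul, derivative_X, derivative_ofNat, ih.2, h3,
      derivative_add, derivative_natCast, derivative_one]
    push_cast
    ring

theorem derivative_hermiteH_succ (n : ℕ) :
    derivative (hermiteH (n + 1)) = 2 * ((n : ℝ[X]) + 1) * hermiteH n :=
  (hermiteH_succ_and_derivative n).2

theorem hermiteH_ode (n : ℕ) :
    derivative (derivative (hermiteH n)) - 2 * X * derivative (hermiteH n) =
      -(2 * (n : ℝ[X])) * hermiteH n := by
  have h := derivative_hermiteH_succ n
  rw [(hermiteH_succ_and_derivative n).1] at h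
  simp only [derivative_sub, derivative_mul, derivative_X, derivative_ofNat] at h
  linear_combination -h

theorem hermiteH_ne_zero (n : ℕ) : hermiteH n ≠ 0 := by
  induction n with
  | zero => simp [hermiteH]
  | succ n ih =>
    intro h
    have := derivative_hermiteH_succ n
    rw [h, derivative_zero] at this
    have h2 : (2 * ((n : ℝ[X]) + 1)) ≠ 0 := by exact_mod_cast (by omega : 2 * (n + 1) ≠ 0)
    exact mul_ne_zero h2 ih this.symm

/-- The Wronskian, as a polynomial, of the Hermite polynomials indexed by a list. -/
noncomputable def polyWronskian (l : List ℕ) : ℝ[X] :=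
  Matrix.det (Matrix.of fun i j : Fin l.length => derivative^[i] (hermiteH (l.get j)))

theorem hermiteWronskian_eq_eval (S : Finset ℕ) (z : ℝ) :
    hermiteWronskian S z = (polyWronskian (S.sort (· ≤ ·))).eval z := by
  have hit : ∀ (p : ℝ[X]) (i : ℕ), iteratedDeriv i (fun x => p.eval x) z =
      (derivative^[i] p).eval z := by
    intro p i
    induction i generalizing p with
    | zero => simp
    | succ i ih =>
      rw [iteratedDeriv_succ', Function.iterate_succ_apply, ← ih]
      congr 1
      ext x
      exact p.deriv
  rw [hermiteWronskian, _root_.wronskian, polyWronskian, ← coe_evalRingHom, RingHom.map_det,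
    ← Matrix.det_submatrix_equiv_self (finCongr (List.length_map (as := S.sort (· ≤ ·))
      fun n => fun x => (hermiteH n).eval x).symm)]
  congr 1
  ext i j
  simp [hit]

variable {K : Type*} [Field K] [Algebra ℝ[X] K] {D : Derivation ℤ K K}

theorem algebraMap_iterate_derivative
    (hD : ∀ p : ℝ[X], D (algebraMap ℝ[X] K p) = algebraMap ℝ[X] K (derivative p)) (n : ℕ)
    (p : ℝ[X]) : algebraMap ℝ[X] K (derivative^[n] p) = D^[n] (algebraMap ℝ[X] K p) :=
  Function.Semiconj.iterate_right (f := algebraMap ℝ[X] K) (fun p => (hD p).symm) n p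

theorem algebraMap_polyWronskian
    (hD : ∀ p : ℝ[X], D (algebraMap ℝ[X] K p) = algebraMap ℝ[X] K (derivative p)) (l : List ℕ) :
    algebraMap ℝ[X] K (polyWronskian l) =
      fieldWronskian D (l.map fun n => algebraMap ℝ[X] K (hermiteH n)) := by
  rw [fieldWronskian_map, polyWronskian, RingHom.map_det]
  congr 1
  ext i j
  exact algebraMap_iterate_derivative hD _ _

theorem isEigen_hermiteH
    (hD : ∀ p : ℝ[X], D (algebraMap ℝ[X] K p) = algebraMap ℝ[X] K (derivative p)) (n : ℕ) :
    IsEigen D (algebraMap ℝ[X] K X) 0 (-(2 * (n : K))) (algebraMap ℝ[X] K (hermiteH n)) := by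
  have := congrArg (algebraMap ℝ[X] K) (hermiteH_ode n)
  simp only [map_sub, map_mul, map_neg, map_ofNat, map_natCast, ← hD] at this
  rw [IsEigen, zero_mul, add_zero, this]

/-- Removing the constant Hermite polynomial shifts the remaining indices down by one. -/
theorem polyWronskian_zero_cons [FaithfulSMul ℝ[X] K]
    (hD : ∀ p : ℝ[X], D (algebraMap ℝ[X] K p) = algebraMap ℝ[X] K (derivative p)) (l : List ℕ) :
    ∃ c : ℝ, c ≠ 0 ∧ polyWronskian (0 :: l.map (· + 1)) = C c * polyWronskian l := by
  refine ⟨∏ j : Fin l.length, (2 * ((l.get j : ℝ) + 1)),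
    Finset.prod_ne_zero_iff.mpr fun j _ => by positivity, ?_⟩
  apply FaithfulSMul.algebraMap_injective ℝ[X] K
  have hd : ∀ n : ℕ, darboux D 1 (algebraMap ℝ[X] K (hermiteH (n + 1))) =
      algebraMap ℝ[X] K (C (2 * ((n : ℝ) + 1)) * hermiteH n) := by
    intro n
    rw [darboux, hD, derivative_hermiteH_succ]
    have hC : (C 2 : ℝ[X]) = 2 := rfl
    simp [hC]
  rw [algebraMap_polyWronskian hD, List.map_cons, fieldWronskian_cons, hermiteH, map_one, one_mul,
    List.map_map, List.map_map, fieldWronskian_map, polyWronskian, map_prod,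
    ← Matrix.det_mul_row, RingHom.map_det]
  congr 1
  ext i j
  simp only [Function.comp, hd, Matrix.of_apply, RingHom.mapMatrix_apply, Matrix.map_apply,
    ← algebraMap_iterate_derivative hD,
    iterate_derivative_C_mul]

theorem polyWronskian_perm [FaithfulSMul ℝ[X] K]
    (hD : ∀ p : ℝ[X], D (algebraMap ℝ[X] K p) = algebraMap ℝ[X] K (derivative p))
    {l₁ l₂ : List ℕ} (h : l₁.Perm l₂) :
    ∃ c : ℝ, c ≠ 0 ∧ polyWronskian l₁ = C c * polyWronskian l₂ := by
  have hinj := FaithfulSMul.algebraMap_injective ℝ[X] K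
  rcases fieldWronskian_map_perm D h (fun n => algebraMap ℝ[X] K (hermiteH n)) with h | h
  · exact ⟨1, one_ne_zero, hinj (by simpa [algebraMap_polyWronskian hD] using h)⟩
  · exact ⟨-1, by simp, hinj (by simpa [algebraMap_polyWronskian hD] using h)⟩

theorem polyWronskian_ne_zero [FaithfulSMul ℝ[X] K]
    (hD : ∀ p : ℝ[X], D (algebraMap ℝ[X] K p) = algebraMap ℝ[X] K (derivative p))
    {l : List ℕ} (hl : l.Nodup) : polyWronskian l ≠ 0 := by
  have hinj := FaithfulSMul.algebraMap_injective ℝ[X] K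
  intro h
  have h0 := algebraMap_polyWronskian hD l
  have hK : CharZero K := charZero_of_injective_algebraMap hinj
  refine fieldWronskian_ne_zero (D := D) (z := algebraMap ℝ[X] K X) (U := 0) (by simp [hD])
    (fun n : ℕ => -(2 * (n : K))) (fun n => by
      simpa using D.map_intCast (-(2 * (n : ℤ)))) l
    (fun n => algebraMap ℝ[X] K (hermiteH n))
    (fun n _ => (map_ne_zero_iff _ hinj).mpr (hermiteH_ne_zero n))
    (fun n _ => isEigen_hermiteH hD n) (hl.imp fun h => by simpa using h) ?_
  rw [← h0, h, map_zero]

theorem hirota_polyWronskian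
    (hD : ∀ p : ℝ[X], D (algebraMap ℝ[X] K p) = algebraMap ℝ[X] K (derivative p))
    (l : List ℕ) (n : ℕ) :
    hirota D (algebraMap ℝ[X] K X) (algebraMap ℝ[X] K (polyWronskian l))
        (algebraMap ℝ[X] K (polyWronskian (l ++ [n]))) =
      (-(2 * (n : K)) + 2 * l.length) * (algebraMap ℝ[X] K (polyWronskian l) *
        algebraMap ℝ[X] K (polyWronskian (l ++ [n]))) := by
  rw [algebraMap_polyWronskian hD, algebraMap_polyWronskian hD,
    hirota_fieldWronskian (U := 0) (by simp [hD]) (fun n : ℕ => -(2 * (n : K))) (fun n => by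
      simpa using D.map_intCast (-(2 * (n : ℤ)))) l n
      (fun n => algebraMap ℝ[X] K (hermiteH n)) (fun n _ => isEigen_hermiteH hD n)
      (isEigen_hermiteH hD n), sub_zero]

theorem polyWronskian_zero_one_two_append [FaithfulSMul ℝ[X] K]
    (hD : ∀ p : ℝ[X], D (algebraMap ℝ[X] K p) = algebraMap ℝ[X] K (derivative p)) (l : List ℕ) :
    ∃ c : ℝ, c ≠ 0 ∧ polyWronskian (0 :: 1 :: 2 :: l.map (· + 3)) = C c * polyWronskian l := by
  obtain ⟨c₁, hc₁, e₁⟩ := polyWronskian_zero_cons hD l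
  obtain ⟨c₂, hc₂, e₂⟩ := polyWronskian_zero_cons hD (0 :: l.map (· + 1))
  obtain ⟨c₃, hc₃, e₃⟩ := polyWronskian_zero_cons hD (0 :: 1 :: l.map (· + 2))
  refine ⟨c₃ * c₂ * c₁, by positivity, ?_⟩
  simp only [List.map_cons, List.map_map, Function.comp_def, add_assoc, zero_add,
    Nat.reduceAdd] at e₂ e₃
  rw [e₃, e₂, e₁, C_mul, C_mul]
  ring

end Hermite

section Okamoto

open Polynomial

theorem mem_OmegaMaya {a1 a2 n : ℕ} :
    n ∈ OmegaMaya a1 a2 ↔ n % 3 = 1 ∧ n < 1 + 3 * a1 ∨ n % 3 = 2 ∧ n < 2 + 3 * a2 := by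
  simp only [OmegaMaya, Finset.mem_union, Finset.mem_image, Finset.mem_range]
  constructor
  · rintro (⟨i, h, rfl⟩ | ⟨i, h, rfl⟩) <;> omega
  · rintro (h | h)
    · exact .inl ⟨n / 3, by omega, by omega⟩
    · exact .inr ⟨n / 3, by omega, by omega⟩

theorem card_OmegaMaya (a1 a2 : ℕ) : (OmegaMaya a1 a2).card = a1 + a2 := by
  rw [OmegaMaya, Finset.card_union_of_disjoint, Finset.card_image_of_injective,
    Finset.card_image_of_injective, Finset.card_range, Finset.card_range]
  · intro i j h; simpa using h
  · intro i j h; simpa using h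
  · rw [Finset.disjoint_left]
    simp only [Finset.mem_image, Finset.mem_range]
    rintro _ ⟨i, _, rfl⟩ ⟨j, _, h⟩
    omega

theorem nodup_zero_one_two_append {l : List ℕ} (hl : l.Nodup) :
    (0 :: 1 :: 2 :: l.map (· + 3)).Nodup := by
  have : (l.map (· + 3)).Nodup := hl.map fun a b h => by simpa using h
  simpa using this

/-- The numerator of `(log P / Q)' - 2 X` over the denominator `P * Q`. -/
noncomputable def okamotoNum (P Q : ℝ[X]) : ℝ[X] :=
  derivative P * Q - P * derivative Q - 2 * X * (P * Q)

/-- The numerator of `(M / Δ ^ n)'` over the denominator `Δ ^ (n + 1)`. -/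
noncomputable def derivNum (n : ℕ) (M Δ : ℝ[X]) : ℝ[X] :=
  derivative M * Δ - n * M * derivative Δ

/-- The Painlevé IV equation for `(log P / Q)' - 2 X`, with denominators cleared. -/
theorem okamoto_polynomial_identity_of_derivation {K : Type*} [Field K] [Algebra ℝ[X] K]
    [FaithfulSMul ℝ[X] K] {D : Derivation ℤ K K}
    (hD : ∀ p : ℝ[X], D (algebraMap ℝ[X] K p) = algebraMap ℝ[X] K (derivative p))
    {a1 a2 : ℕ} (h1 : 1 ≤ a1) (h2 : 1 ≤ a2) {P Q Δ M : ℝ[X]}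
    (hP : P = polyWronskian ((OmegaMaya a1 a2).sort (· ≤ ·)))
    (hQ : Q = polyWronskian ((OmegaMaya (a1 - 1) (a2 - 1)).sort (· ≤ ·)))
    (hΔ : Δ = P * Q) (hM : M = okamotoNum P Q) :
    2 * M * derivNum 2 (derivNum 1 M Δ) Δ - derivNum 1 M Δ ^ 2
      + (2 - 6 * ((a1 : ℝ[X]) - (a2 : ℝ[X]))) ^ 2 * Δ ^ 4
      + M ^ 2 * (-3 * M ^ 2 - 24 * X * M * Δ - 36 * X ^ 2 * Δ ^ 2
        + 12 * ((a1 : ℝ[X]) + (a2 : ℝ[X])) * Δ ^ 2) = 0 := by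
  have hinj := FaithfulSMul.algebraMap_injective ℝ[X] K
  set ι := algebraMap ℝ[X] K with hι
  set l := (OmegaMaya a1 a2).sort (· ≤ ·) with hl
  set l' := (OmegaMaya (a1 - 1) (a2 - 1)).sort (· ≤ ·) with hl'
  have hmem : ∀ n, n ∈ l ↔ n % 3 = 1 ∧ n < 1 + 3 * a1 ∨ n % 3 = 2 ∧ n < 2 + 3 * a2 :=
    fun n => by rw [hl, Finset.mem_sort, mem_OmegaMaya]
  have hmem' : ∀ n, n ∈ l' ↔
      n % 3 = 1 ∧ n < 1 + 3 * (a1 - 1) ∨ n % 3 = 2 ∧ n < 2 + 3 * (a2 - 1) :=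
    fun n => by rw [hl', Finset.mem_sort, mem_OmegaMaya]
  have hn : l.Nodup := Finset.sort_nodup _ _
  have hn' : l'.Nodup := Finset.sort_nodup _ _
  have hlen : l.length = a1 + a2 := by rw [hl, Finset.length_sort, card_OmegaMaya]
  have hn₁ : (l ++ [0]).Nodup := by
    rw [List.nodup_append]
    refine ⟨hn, by simp, fun n hn m hm => ?_⟩
    rw [hmem] at hn
    simp only [List.mem_singleton] at hm
    omega
  have hn₂ : (l ++ [0] ++ [1 + 3 * a1]).Nodup := by
    rw [List.nodup_append]
    refine ⟨hn₁, by simp, fun n hn m hm => ?_⟩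
    simp only [List.mem_append, hmem, List.mem_singleton] at hn hm
    omega
  have hn₃ : (l ++ [0] ++ [1 + 3 * a1] ++ [2 + 3 * a2]).Nodup := by
    rw [List.nodup_append]
    refine ⟨hn₂, by simp, fun n hn m hm => ?_⟩
    simp only [List.mem_append, hmem, List.mem_singleton] at hn hm
    omega
  have hp₁ : (l ++ [0]).Perm (0 :: 1 :: 2 :: l'.map (· + 3)) := by
    rw [List.perm_ext_iff_of_nodup hn₁ (nodup_zero_one_two_append hn')]
    intro n
    simp only [List.mem_append, List.mem_cons, List.mem_map, hmem, hmem', List.not_mem_nil,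
      or_false]
    constructor
    · intro h
      by_cases h3 : n < 3
      · omega
      · exact .inr (.inr (.inr ⟨n - 3, by omega, by omega⟩))
    · rintro (h | h | h | ⟨m, h, rfl⟩) <;> omega
  have hp₃ : (l ++ [0] ++ [1 + 3 * a1] ++ [2 + 3 * a2]).Perm
      (0 :: 1 :: 2 :: l.map (· + 3)) := by
    rw [List.perm_ext_iff_of_nodup hn₃ (nodup_zero_one_two_append hn)]
    intro n
    simp only [List.mem_append, List.mem_cons, List.mem_map, hmem, List.not_mem_nil,
      or_false]
    constructor
    · intro h
      by_cases h3 : n < 3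
      · omega
      · exact .inr (.inr (.inr ⟨n - 3, by omega, by omega⟩))
    · rintro (h | h | h | ⟨m, h, rfl⟩) <;> omega
  have hconst : ∀ c : ℝ, D (ι (C c)) = 0 := fun c => by rw [hD]; simp
  have hc0 : ∀ {c : ℝ}, c ≠ 0 → ι (C c) ≠ 0 := fun h => by
    rw [map_ne_zero_iff _ hinj]; simpa using h
  obtain ⟨c₁, hc₁, e₁⟩ : ∃ c : ℝ, c ≠ 0 ∧ polyWronskian (l ++ [0]) = C c * Q := by
    obtain ⟨c, hc, e⟩ := polyWronskian_perm hD hp₁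
    obtain ⟨c', hc', e'⟩ := polyWronskian_zero_one_two_append hD l'
    exact ⟨c * c', mul_ne_zero hc hc', by rw [e, e', hQ, C_mul, mul_assoc]⟩
  obtain ⟨c₃, hc₃, e₃⟩ : ∃ c : ℝ, c ≠ 0 ∧
      polyWronskian (l ++ [0] ++ [1 + 3 * a1] ++ [2 + 3 * a2]) = C c * P := by
    obtain ⟨c, hc, e⟩ := polyWronskian_perm hD hp₃
    obtain ⟨c', hc', e'⟩ := polyWronskian_zero_one_two_append hD l
    exact ⟨c * c', mul_ne_zero hc hc', by rw [e, e', hP, C_mul, mul_assoc]⟩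
  have hP0 : ι P ≠ 0 := (map_ne_zero_iff _ hinj).mpr (hP ▸ polyWronskian_ne_zero hD hn)
  have hQ0 : ι Q ≠ 0 := (map_ne_zero_iff _ hinj).mpr (hQ ▸ polyWronskian_ne_zero hD hn')
  have hτ₁ : ι (polyWronskian (l ++ [0])) ≠ 0 :=
    (map_ne_zero_iff _ hinj).mpr (polyWronskian_ne_zero hD hn₁)
  have hτ₂ : ι (polyWronskian (l ++ [0] ++ [1 + 3 * a1])) ≠ 0 :=
    (map_ne_zero_iff _ hinj).mpr (polyWronskian_ne_zero hD hn₂)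
  have b₀ := hirota_polyWronskian hD l 0
  have b₁ := hirota_polyWronskian hD (l ++ [0]) (1 + 3 * a1)
  have b₂ := hirota_polyWronskian hD (l ++ [0] ++ [1 + 3 * a1]) (2 + 3 * a2)
  rw [e₃, map_mul, hirota_mul_const (hconst c₃), mul_left_comm (ι _) (ι (C c₃)),
    mul_left_comm _ (ι (C c₃))] at b₂
  replace b₂ := mul_left_cancel₀ (hc0 hc₃) b₂
  rw [← hP] at b₀
  have hquot : D (ι (polyWronskian (l ++ [0]))) / ι (polyWronskian (l ++ [0])) =
      ι (derivative Q) / ι Q := by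
    have := hc0 hc₁
    rw [e₁, map_mul, Derivation.leibniz, hconst, hD]
    simp only [smul_eq_mul]
    field_simp
    ring
  have hΔ0 : ι Δ ≠ 0 := by rw [hΔ, map_mul]; exact mul_ne_zero hP0 hQ0
  have hY : ι M / ι Δ = D (ι P) / ι P -
      D (ι (polyWronskian (l ++ [0]))) / ι (polyWronskian (l ++ [0])) - 2 * ι X := by
    rw [hquot, hM, hΔ, okamotoNum, hD]
    simp only [map_sub, map_mul, map_ofNat]
    field_simp
  have hderiv : ∀ (n : ℕ) (N : ℝ[X]),
      D (ι N / ι Δ ^ n) = ι (derivNum n N Δ) / ι Δ ^ (n + 1) := by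
    intro n N
    rw [Derivation.leibniz_div, Derivation.leibniz_pow, hD, hD, derivNum]
    cases n with
    | zero => simp; field_simp
    | succ n =>
      simp only [smul_eq_mul, nsmul_eq_mul, map_sub, map_mul, map_natCast, Nat.add_sub_cancel]
      field_simp
      ring
  have hY1 : D (ι M / ι Δ) = ι (derivNum 1 M Δ) / ι Δ ^ 2 := by
    simpa using hderiv 1 M
  have hY2 := hderiv 2 (derivNum 1 M Δ)
  have hnat : ∀ n m : ℕ, D (-(2 * (n : K)) + 2 * m) = 0 := fun n m => by
    simpa using D.map_intCast (-(2 * (n : ℤ)) + 2 * m)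
  have main := painleve_of_hirota_cycle (by rw [hD, derivative_X, map_one]) hP0 hτ₁ hτ₂
    (hnat _ _) (hnat _ _) b₀ b₁ b₂ hY
  rw [hY1, hY2] at main
  apply hinj
  simp only [List.length_append, List.length_singleton, hlen] at main
  push_cast at main
  field_simp at main
  simp only [map_add, map_sub, map_mul, map_pow, map_neg, map_ofNat, map_natCast, map_zero]
  linear_combination main

theorem okamoto_polynomial_identity {a1 a2 : ℕ} (h1 : 1 ≤ a1) (h2 : 1 ≤ a2) {P Q Δ M : ℝ[X]}
    (hP : P = polyWronskian ((OmegaMaya a1 a2).sort (· ≤ ·)))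
    (hQ : Q = polyWronskian ((OmegaMaya (a1 - 1) (a2 - 1)).sort (· ≤ ·)))
    (hΔ : Δ = P * Q) (hM : M = okamotoNum P Q) :
    2 * M * derivNum 2 (derivNum 1 M Δ) Δ - derivNum 1 M Δ ^ 2
      + (2 - 6 * ((a1 : ℝ[X]) - (a2 : ℝ[X]))) ^ 2 * Δ ^ 4
      + M ^ 2 * (-3 * M ^ 2 - 24 * X * M * Δ - 36 * X ^ 2 * Δ ^ 2
        + 12 * ((a1 : ℝ[X]) + (a2 : ℝ[X])) * Δ ^ 2) = 0 := by
  obtain ⟨D, hD⟩ := exists_derivation_extending (K := FractionRing ℝ[X])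
    ((derivative' : Derivation ℝ ℝ[X] ℝ[X]).restrictScalars ℤ)
  exact okamoto_polynomial_identity_of_derivation hD h1 h2 hP hQ hΔ hM

theorem hasDerivAt_eval_div_pow (n : ℕ) (N Δ : ℝ[X]) {z : ℝ} (hz : Δ.eval z ≠ 0) :
    HasDerivAt (fun x => N.eval x / Δ.eval x ^ n)
      ((derivNum n N Δ).eval z / Δ.eval z ^ (n + 1)) z := by
  refine ((N.hasDerivAt z).div ((Δ.hasDerivAt z).pow n) (pow_ne_zero n hz)).congr_deriv ?_
  simp only [derivNum, Pi.pow_apply]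
  cases n with
  | zero => simp; field_simp
  | succ n =>
    simp only [eval_sub, eval_mul, eval_natCast, Nat.add_sub_cancel]
    field_simp
    ring

theorem hasDerivAt_eval_div_pow_comp_div_sqrt_three (c : ℝ) (n : ℕ) (N Δ : ℝ[X]) {t : ℝ}
    (ht : Δ.eval (t / Real.sqrt 3) ≠ 0) :
    HasDerivAt (fun s => c * (N.eval (s / Real.sqrt 3) / Δ.eval (s / Real.sqrt 3) ^ n))
      (c / Real.sqrt 3 * ((derivNum n N Δ).eval (t / Real.sqrt 3) /
        Δ.eval (t / Real.sqrt 3) ^ (n + 1))) t := by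
  have := ((hasDerivAt_eval_div_pow n N Δ ht).comp t
    ((hasDerivAt_id t).div_const (Real.sqrt 3))).const_mul c
  refine this.congr_deriv ?_
  ring

end Okamoto

/-- rational solutions of Painlevé IV from Okamoto polynomials: for
`α₁, α₂ ≥ 1`, the function
`y(t) = −2t/3 + (d/dt) log(H^{Ω_{α₁,α₂}}(t/√3) / H^{Ω_{α₁−1,α₂−1}}(t/√3))`
satisfies, wherever the two Hermite Wronskians and `y` are nonzero, the Painlevé IV
equation with parameters `a = α₁ + α₂` and `b = −(2/9)(3(α₁−α₂) − 1)²`. -/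
theorem painleveIV_okamoto (a1 a2 : ℕ) (h1 : 1 ≤ a1) (h2 : 1 ≤ a2) (y : ℝ → ℝ)
    (hy : y = fun t => -2 * t / 3 + deriv (fun s =>
        Real.log (hermiteWronskian (OmegaMaya a1 a2) (s / Real.sqrt 3) /
          hermiteWronskian (OmegaMaya (a1 - 1) (a2 - 1)) (s / Real.sqrt 3))) t) :
    ∀ t : ℝ,
      hermiteWronskian (OmegaMaya a1 a2) (t / Real.sqrt 3) ≠ 0 →
      hermiteWronskian (OmegaMaya (a1 - 1) (a2 - 1)) (t / Real.sqrt 3) ≠ 0 →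
      y t ≠ 0 →
      deriv (deriv y) t =
        (deriv y t) ^ 2 / (2 * y t) + (3 / 2) * (y t) ^ 3 + 4 * t * (y t) ^ 2
          + 2 * (t ^ 2 - ((a1 : ℝ) + (a2 : ℝ))) * y t
          + (-((2 : ℝ) / 9) * (3 * ((a1 : ℝ) - (a2 : ℝ)) - 1) ^ 2) / y t := by
  obtain ⟨P, hP⟩ : ∃ P, P = polyWronskian ((OmegaMaya a1 a2).sort (· ≤ ·)) := ⟨_, rfl⟩
  obtain ⟨Q, hQ⟩ : ∃ Q, Q = polyWronskian ((OmegaMaya (a1 - 1) (a2 - 1)).sort (· ≤ ·)) :=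
    ⟨_, rfl⟩
  obtain ⟨Δ, hΔ⟩ : ∃ Δ, Δ = P * Q := ⟨_, rfl⟩
  obtain ⟨M, hM⟩ : ∃ M, M = okamotoNum P Q := ⟨_, rfl⟩
  have key := okamoto_polynomial_identity h1 h2 hP hQ hΔ hM
  simp only [hermiteWronskian_eq_eval, ← hP, ← hQ] at hy ⊢
  intro t hPt hQt hyt
  have h3 : Real.sqrt 3 ≠ 0 := by positivity
  have hs3 : Real.sqrt 3 ^ 2 = 3 := Real.sq_sqrt (by norm_num)
  have hopen : IsOpen {s : ℝ | Δ.eval (s / Real.sqrt 3) ≠ 0} :=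
    isOpen_ne_fun (by fun_prop) continuous_const
  have hΔt : Δ.eval (t / Real.sqrt 3) ≠ 0 := by
    rw [hΔ, Polynomial.eval_mul]; exact mul_ne_zero hPt hQt
  have hy0 : ∀ s, Δ.eval (s / Real.sqrt 3) ≠ 0 → y s =
      1 / Real.sqrt 3 * (M.eval (s / Real.sqrt 3) / Δ.eval (s / Real.sqrt 3) ^ 1) := by
    intro s hs
    rw [hΔ, Polynomial.eval_mul] at hs
    have hPs := left_ne_zero_of_mul hs
    have hQs := right_ne_zero_of_mul hs
    have hd := (hasDerivAt_id s).div_const (Real.sqrt 3)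
    have hPd := (P.hasDerivAt (s / Real.sqrt 3)).comp s hd
    have hQd := (Q.hasDerivAt (s / Real.sqrt 3)).comp s hd
    have hlog := ((hPd.div hQd hQs).log (div_ne_zero hPs hQs)).deriv
    rw [hy]
    refine (congrArg (-2 * s / 3 + ·) hlog).trans ?_
    simp only [hM, hΔ, okamotoNum, Polynomial.eval_sub, Polynomial.eval_mul, Polynomial.eval_X,
      Polynomial.eval_ofNat, Function.comp_apply, Pi.div_apply, id]
    field_simp
    linear_combination
      (-2 * s * Q.eval (s / Real.sqrt 3) * P.eval (s / Real.sqrt 3)) * hs3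
  have hy1 : ∀ s, Δ.eval (s / Real.sqrt 3) ≠ 0 → deriv y s =
      1 / Real.sqrt 3 / Real.sqrt 3 * ((derivNum 1 M Δ).eval (s / Real.sqrt 3) /
        Δ.eval (s / Real.sqrt 3) ^ 2) := fun s hs => by
    rw [Filter.EventuallyEq.deriv_eq (Filter.eventually_of_mem (hopen.mem_nhds hs) hy0)]
    exact (hasDerivAt_eval_div_pow_comp_div_sqrt_three _ 1 M Δ hs).deriv
  have hy2 : deriv (deriv y) t =
      1 / Real.sqrt 3 / Real.sqrt 3 / Real.sqrt 3 *
        ((derivNum 2 (derivNum 1 M Δ) Δ).eval (t / Real.sqrt 3) /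
          Δ.eval (t / Real.sqrt 3) ^ 3) := by
    rw [Filter.EventuallyEq.deriv_eq (Filter.eventually_of_mem (hopen.mem_nhds hΔt) hy1)]
    exact (hasDerivAt_eval_div_pow_comp_div_sqrt_three _ 2 _ Δ hΔt).deriv
  replace key := congrArg (Polynomial.eval (t / Real.sqrt 3)) key
  simp only [Polynomial.eval_add, Polynomial.eval_sub, Polynomial.eval_mul, Polynomial.eval_pow,
    Polynomial.eval_neg, Polynomial.eval_X, Polynomial.eval_ofNat, Polynomial.eval_natCast,
    Polynomial.eval_zero] at key
  have hzt : t = Real.sqrt 3 * (t / Real.sqrt 3) := by field_simp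
  have hy0t := hy0 t hΔt
  have hy1t := hy1 t hΔt
  generalize t / Real.sqrt 3 = z at *
  generalize (derivNum 2 (derivNum 1 M Δ) Δ).eval z = M₂ at *
  generalize (derivNum 1 M Δ).eval z = M₁ at *
  have hMz : M.eval z ≠ 0 := fun h => hyt (by rw [hy0t, h]; simp)
  rw [hy2, hy1t, hy0t, hzt]
  generalize M.eval z = m at *
  generalize Δ.eval z = d at *
  generalize Real.sqrt 3 = r at *
  have hr4 : r ^ 4 = 9 := by linear_combination (r ^ 2 + 3) * hs3
  field_simp
  simp only [hs3, hr4]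
  linear_combination 9 * key
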